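/- (Single point strategy, flagging rule.) Let M be a mine placement on an n × m board and let x be a mine-free cell. Let F and R be disjoint sets of neighbours of x such that every cell in F contains a mine (the correctly flagged neighbours) and every cell in R is mine-free (the already revealed neighbours), and let C be the set of neighbours of x lying in neither F nor R (the covered neighbours). If value(x) − |F| equals the cardinality of C (i.e., MinesLeft(x) equals the number of covered neighbours), then every cell in C contains a mine. -/

import Mathlib

/-- The set of neighbours of a cell in an `n × m` grid: cells distinct from `c`
whose row and column indices each differ from those of `c` by at most 1. -/
def neighbours {n m : ℕ} (c : Fin n × Fin m) : Finset (Fin n × Fin m) :=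
  Finset.univ.filter (fun d =>
    d ≠ c ∧ |(d.1.val : ℤ) - (c.1.val : ℤ)| ≤ 1 ∧ |(d.2.val : ℤ) - (c.2.val : ℤ)| ≤ 1)

/-- The value of a cell: the number of its neighbours that contain mines,
for the mine placement `M`. -/
def value {n m : ℕ} (M : Fin n × Fin m → Bool) (c : Fin n × Fin m) : ℕ :=
  ((neighbours c).filter (fun d => M d = true)).card

/-- Single point strategy, flagging rule: if `x` is a mine-free cell, `F` is a set
of correctly flagged (mined) neighbours of `x`, `R` is a set of revealed (mine-free)
neighbours of `x` disjoint from `F`, `C` is the set of remaining (covered) neighbours,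
and `value x − |F| = |C|`, then every covered neighbour of `x` contains a mine. -/
theorem single_point_flagging {n m : ℕ} (M : Fin n × Fin m → Bool)
    (x : Fin n × Fin m) (hx : M x = false)
    (F R : Finset (Fin n × Fin m))
    (hF : F ⊆ neighbours x) (hR : R ⊆ neighbours x)
    (hdisj : Disjoint F R)
    (hFmine : ∀ f ∈ F, M f = true)
    (hRfree : ∀ r ∈ R, M r = false)
    (C : Finset (Fin n × Fin m)) (hC : C = (neighbours x) \ (F ∪ R))
    (hval : value M x - F.card = C.card) :
    ∀ c ∈ C, M c = true := by
  have hsub : (neighbours x).filter (fun d => M d = true) ⊆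
      F ∪ C.filter (fun d => M d = true) := by
    intro d hd
    rw [Finset.mem_filter] at hd
    by_cases hdF : d ∈ F
    · exact Finset.mem_union_left _ hdF
    · have hdR : d ∉ R := fun h => by
        have h1 := hRfree d h
        rw [hd.2] at h1
        exact Bool.noConfusion h1
      refine Finset.mem_union_right _ (Finset.mem_filter.2 ⟨?_, hd.2⟩)
      rw [hC, Finset.mem_sdiff, Finset.mem_union]
      exact ⟨hd.1, fun h => h.elim hdF hdR⟩
  have h1 : value M x ≤ F.card + (C.filter (fun d => M d = true)).card :=
    (Finset.card_le_card hsub).trans (Finset.card_union_le _ _)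
  have h2 : C.card ≤ (C.filter (fun d => M d = true)).card := by omega
  have h3 := Finset.eq_of_subset_of_card_le (Finset.filter_subset (fun d => M d = true) C) h2
  intro c hc
  rw [← h3] at hc
  exact (Finset.mem_filter.1 hc).2
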